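/- Let μ = 1/4 (so ν = 0), let d ≥ 1 and let ε ∈ (0,1). Then there exists C > 0 such that for all t ≥ t₀ ≥ 0 and all ξ ∈ ℝ^d \ {0}: |E_0(t,t₀,ξ)| ≤ C (1 + |ξ|^{−1/2 − ε}) and |E_0(t,t₀,ξ)| ≤ C (1+t)^{1/2} (1+t₀)^{−1/2} (1 + log((1+t)/(1+t₀))); |E_1(t,t₀,ξ)| ≤ C |ξ|^{−1} and |E_1(t,t₀,ξ)| ≤ C (1+t)^{1/2} (1+t₀)^{1/2} (1 + log((1+t)/(1+t₀))); |Ė_0(t,t₀,ξ)| ≤ C (1 + |ξ|); and |Ė_1(t,t₀,ξ)| ≤ C. -/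

import Mathlib

open MeasureTheory Real Set

noncomputable section

/-- Bessel function of the first kind `J_ν(τ)`, defined by its power series,
using the principal branch of `(τ/2)^(ν+2k)`. -/
def besselJ (ν : ℂ) (τ : ℝ) : ℂ :=
  ∑' k : ℕ, ((-1 : ℂ) ^ k / ((Nat.factorial k : ℂ) * Complex.Gamma (ν + k + 1))) *
    ((τ : ℂ) / 2) ^ (ν + 2 * (k : ℂ))

/-- Bessel function of the second kind (Neumann function) `Y_ν(τ)` for `ν ∉ ℤ`. -/
def besselY (ν : ℂ) (τ : ℝ) : ℂ :=
  (besselJ ν τ * Complex.cos (ν * (π : ℂ)) - besselJ (-ν) τ) / Complex.sin (ν * (π : ℂ))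

/-- The index `ν` associated with the mass parameter `μ`. -/
def nuOf (μ : ℝ) : ℂ :=
  if μ ≤ 1 / 4 then ((Real.sqrt (1 - 4 * μ) / 2 : ℝ) : ℂ)
  else Complex.I * ((Real.sqrt (4 * μ - 1) / 2 : ℝ) : ℂ)

/-- `e₊(t,ξ) = τ^{1/2} J_ν(τ)` with `τ = (1+t) r`, `r = |ξ|`. -/
def ePlus (ν : ℂ) (r t : ℝ) : ℂ :=
  (Real.sqrt ((1 + t) * r) : ℂ) * besselJ ν ((1 + t) * r)

/-- `e₋(t,ξ) = τ^{1/2} Y_ν(τ)` with `τ = (1+t) r`, `r = |ξ|`. -/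
def eMinus (ν : ℂ) (r t : ℝ) : ℂ :=
  (Real.sqrt ((1 + t) * r) : ℂ) * besselY ν ((1 + t) * r)

/-- `ė₊ = ∂ₜ e₊`. -/
def ePlusDot (ν : ℂ) (r t : ℝ) : ℂ := deriv (ePlus ν r) t

/-- `ė₋ = ∂ₜ e₋`. -/
def eMinusDot (ν : ℂ) (r t : ℝ) : ℂ := deriv (eMinus ν r) t

/-- The Fourier multiplier `E₀(t,t₀,ξ)` of the Klein–Gordon propagator. -/
def E0 (ν : ℂ) (r t t₀ : ℝ) : ℂ :=
  (ePlus ν r t * eMinusDot ν r t₀ - ePlusDot ν r t₀ * eMinus ν r t) /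
    (ePlus ν r t₀ * eMinusDot ν r t₀ - ePlusDot ν r t₀ * eMinus ν r t₀)

/-- The Fourier multiplier `E₁(t,t₀,ξ)` of the Klein–Gordon propagator. -/
def E1 (ν : ℂ) (r t t₀ : ℝ) : ℂ :=
  (ePlus ν r t₀ * eMinus ν r t - ePlus ν r t * eMinus ν r t₀) /
    (ePlus ν r t₀ * eMinusDot ν r t₀ - ePlusDot ν r t₀ * eMinus ν r t₀)

/-- `Ė₀ = ∂ₜ E₀` (derivative in the first time variable). -/
def E0dot (ν : ℂ) (r t t₀ : ℝ) : ℂ := deriv (fun s => E0 ν r s t₀) t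

/-- `Ė₁ = ∂ₜ E₁` (derivative in the first time variable). -/
def E1dot (ν : ℂ) (r t t₀ : ℝ) : ℂ := deriv (fun s => E1 ν r s t₀) t

/-- The Neumann function `Y₀(τ)` (logarithmic case `ν = 0`). -/
def besselY0 (τ : ℝ) : ℂ :=
  (2 / (π : ℂ)) * (Complex.log ((τ : ℂ) / 2) + (Real.eulerMascheroniConstant : ℂ)) * besselJ 0 τ +
    (2 / (π : ℂ)) * ∑' k : ℕ,
      ((-1 : ℂ) ^ ((k + 1) + 1) * ((harmonic (k + 1) : ℚ) : ℂ) /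
          ((Nat.factorial (k + 1) : ℂ)) ^ 2) * ((τ : ℂ) / 2) ^ (2 * (k + 1))

/-- `e₋(t,ξ) = τ^{1/2} Y₀(τ)` in the case `μ = 1/4`, `ν = 0`. -/
def eMinusZ (r t : ℝ) : ℂ :=
  (Real.sqrt ((1 + t) * r) : ℂ) * besselY0 ((1 + t) * r)

/-- `ė₋ = ∂ₜ e₋` in the case `μ = 1/4`. -/
def eMinusZDot (r t : ℝ) : ℂ := deriv (eMinusZ r) t

/-- `E₀(t,t₀,ξ)` in the case `μ = 1/4`, `ν = 0`. -/
def E0Z (r t t₀ : ℝ) : ℂ :=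
  (ePlus 0 r t * eMinusZDot r t₀ - ePlusDot 0 r t₀ * eMinusZ r t) /
    (ePlus 0 r t₀ * eMinusZDot r t₀ - ePlusDot 0 r t₀ * eMinusZ r t₀)

/-- `E₁(t,t₀,ξ)` in the case `μ = 1/4`, `ν = 0`. -/
def E1Z (r t t₀ : ℝ) : ℂ :=
  (ePlus 0 r t₀ * eMinusZ r t - ePlus 0 r t * eMinusZ r t₀) /
    (ePlus 0 r t₀ * eMinusZDot r t₀ - ePlusDot 0 r t₀ * eMinusZ r t₀)

/-- `Ė₀` in the case `μ = 1/4`. -/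
def E0Zdot (r t t₀ : ℝ) : ℂ := deriv (fun s => E0Z r s t₀) t

/-- `Ė₁` in the case `μ = 1/4`. -/
def E1Zdot (r t t₀ : ℝ) : ℂ := deriv (fun s => E1Z r s t₀) t

theorem summable_of_abs_le_div_factorial {a : ℕ → ℝ} {M : ℝ}
    (ha : ∀ k, |a k| ≤ M / k.factorial) (x : ℝ) : Summable fun k => a k * x ^ k := by
  refine Summable.of_norm_bounded ((Real.summable_pow_div_factorial |x|).mul_left M) fun k => ?_
  rw [norm_mul, norm_pow, Real.norm_eq_abs, Real.norm_eq_abs]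
  calc |a k| * |x| ^ k ≤ M / k.factorial * |x| ^ k := by gcongr; exact ha k
    _ = M * (|x| ^ k / k.factorial) := by ring

theorem abs_shift_le_div_factorial {a : ℕ → ℝ} {M : ℝ}
    (ha : ∀ k, |a k| ≤ M / k.factorial) (k : ℕ) :
    |((k : ℝ) + 1) * a (k + 1)| ≤ M / k.factorial := by
  rw [abs_mul, abs_of_pos (by positivity)]
  calc ((k : ℝ) + 1) * |a (k + 1)| ≤ ((k : ℝ) + 1) * (M / (k + 1).factorial) := by
        gcongr; exact ha _
    _ = M / k.factorial := by
        rw [Nat.factorial_succ]; push_cast; field_simp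

theorem hasDerivAt_tsum_mul_pow {a : ℕ → ℝ} {M : ℝ}
    (ha : ∀ k, |a k| ≤ M / k.factorial) (x : ℝ) :
    HasDerivAt (fun y => ∑' k, a k * y ^ k) (∑' k : ℕ, ((k : ℝ) + 1) * a (k + 1) * x ^ k) x := by
  have hs := summable_of_abs_le_div_factorial (abs_shift_le_div_factorial ha)
  have hM : 0 ≤ M := by simpa using (abs_nonneg _).trans (ha 0)
  have hbd : Summable fun k : ℕ => M / k.factorial * (k * (|x| + 1) ^ (k - 1)) := by
    rw [← summable_nat_add_iff 1]
    refine ((Real.summable_pow_div_factorial (|x| + 1)).mul_left M).congr fun k => ?_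
    rw [Nat.factorial_succ]; push_cast; field_simp
  have key := hasDerivAt_tsum_of_isPreconnected (𝕜 := ℝ) (F := ℝ)
    (g := fun k y => a k * y ^ k) (g' := fun k y => a k * (k * y ^ (k - 1)))
    (t := Metric.ball 0 (|x| + 1)) (y₀ := 0) (y := x) hbd Metric.isOpen_ball
    (convex_ball _ _).isPreconnected
    (fun k y _ => (hasDerivAt_pow k y).const_mul (a k))
    (fun k y hy => by
      have hy' : |y| ≤ |x| + 1 := by simpa using (mem_ball_zero_iff.1 hy).le
      rw [norm_mul, norm_mul, norm_pow, Real.norm_eq_abs, Real.norm_eq_abs, Real.norm_eq_abs,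
        Nat.abs_cast]
      have := ha k
      gcongr)
    (Metric.mem_ball_self (by positivity)) (summable_of_abs_le_div_factorial ha 0)
    (by simp)
  refine key.congr_deriv ?_
  have hs' : Summable fun k : ℕ => a k * (k * x ^ (k - 1)) := by
    rw [← summable_nat_add_iff 1]
    refine (hs x).congr fun k => ?_
    rw [Nat.add_sub_cancel]; push_cast; ring
  rw [hs'.tsum_eq_zero_add]
  simp only [CharP.cast_eq_zero, zero_mul, mul_zero, zero_add]
  refine tsum_congr fun k => ?_
  rw [Nat.add_sub_cancel]; push_cast; ring

theorem mul_tsum_shift {a : ℕ → ℝ} {M : ℝ} (ha : ∀ k, |a k| ≤ M / k.factorial) (x : ℝ) :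
    Summable (fun k : ℕ => k * a k * x ^ k) ∧
      x * ∑' k : ℕ, ((k : ℝ) + 1) * a (k + 1) * x ^ k = ∑' k : ℕ, k * a k * x ^ k := by
  have hs := summable_of_abs_le_div_factorial (abs_shift_le_div_factorial ha) x
  have h : Summable (fun k : ℕ => k * a k * x ^ k) := by
    rw [← summable_nat_add_iff 1]
    refine (hs.mul_left x).congr fun k => ?_
    push_cast; ring
  refine ⟨h, ?_⟩
  rw [h.tsum_eq_zero_add, ← tsum_mul_left]
  simp only [CharP.cast_eq_zero, zero_mul, zero_add]
  refine tsum_congr fun k => ?_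
  push_cast; ring

/-- Coefficients of `J₀` as a power series in `τ² / 4`. -/
def besselCoeff (k : ℕ) : ℝ := (-1) ^ k / (k.factorial : ℝ) ^ 2

/-- Coefficients, in powers of `τ² / 4`, of the regular part of `Y₀`. -/
def neumannCoeff (k : ℕ) : ℝ := (-1) ^ (k + 1) * (harmonic k : ℝ) / (k.factorial : ℝ) ^ 2

theorem abs_besselCoeff_le (k : ℕ) : |besselCoeff k| ≤ 1 / k.factorial := by
  have h1 : (1 : ℝ) ≤ k.factorial := by exact_mod_cast Nat.one_le_iff_ne_zero.2 k.factorial_ne_zero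
  rw [besselCoeff, abs_div, abs_pow, abs_neg, abs_one, one_pow, abs_of_pos (by positivity)]
  exact one_div_le_one_div_of_le (by positivity) (by nlinarith)

theorem harmonic_le_natCast (k : ℕ) : (harmonic k : ℝ) ≤ k := by
  induction k with
  | zero => simp
  | succ k ih =>
    rw [harmonic_succ]
    push_cast
    gcongr
    exact inv_le_one_of_one_le₀ (by linarith [k.cast_nonneg (α := ℝ)])

theorem abs_neumannCoeff_le (k : ℕ) : |neumannCoeff k| ≤ 1 / k.factorial := by
  have h0 : (0 : ℝ) ≤ harmonic k := by
    rw [harmonic]; positivity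
  have h1 : (harmonic k : ℝ) ≤ k.factorial :=
    (harmonic_le_natCast k).trans (by exact_mod_cast Nat.self_le_factorial k)
  rw [neumannCoeff, abs_div, abs_mul, abs_pow, abs_neg, abs_one, one_pow, one_mul,
    abs_of_nonneg h0, abs_of_pos (by positivity), div_le_div_iff₀ (by positivity) (by positivity)]
  nlinarith [(by positivity : (0 : ℝ) < k.factorial)]

theorem besselCoeff_succ (k : ℕ) :
    ((k : ℝ) + 1) * (((k : ℝ) + 1) * besselCoeff (k + 1)) = -besselCoeff k := by
  simp only [besselCoeff, Nat.factorial_succ]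
  push_cast; field_simp; ring

theorem neumannCoeff_succ (k : ℕ) :
    ((k : ℝ) + 1) * (((k : ℝ) + 1) * neumannCoeff (k + 1)) =
      -neumannCoeff k - ((k : ℝ) + 1) * besselCoeff (k + 1) := by
  simp only [neumannCoeff, besselCoeff, Nat.factorial_succ, harmonic_succ]
  push_cast; field_simp; ring

/-- `J₀` as a function of `x = τ² / 4`. -/
def besselF (x : ℝ) : ℝ := ∑' k, besselCoeff k * x ^ k

/-- Derivative of `besselF`. -/
def besselF' (x : ℝ) : ℝ := ∑' k : ℕ, ((k : ℝ) + 1) * besselCoeff (k + 1) * x ^ k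

/-- The regular part of `Y₀` as a function of `x = τ² / 4`. -/
def neumannG (x : ℝ) : ℝ := ∑' k, neumannCoeff k * x ^ k

/-- Derivative of `neumannG`. -/
def neumannG' (x : ℝ) : ℝ := ∑' k : ℕ, ((k : ℝ) + 1) * neumannCoeff (k + 1) * x ^ k

theorem hasDerivAt_besselF (x : ℝ) : HasDerivAt besselF (besselF' x) x :=
  hasDerivAt_tsum_mul_pow abs_besselCoeff_le x

theorem hasDerivAt_neumannG (x : ℝ) : HasDerivAt neumannG (neumannG' x) x :=
  hasDerivAt_tsum_mul_pow abs_neumannCoeff_le x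

theorem exists_hasDerivAt_besselF' (x : ℝ) :
    ∃ F'' : ℝ, HasDerivAt besselF' F'' x ∧ x * F'' + besselF' x + besselF x = 0 := by
  have hb := abs_shift_le_div_factorial abs_besselCoeff_le
  refine ⟨_, hasDerivAt_tsum_mul_pow hb x, ?_⟩
  obtain ⟨h1, h2⟩ := mul_tsum_shift hb x
  rw [h2, besselF', besselF, ← h1.tsum_add (summable_of_abs_le_div_factorial hb x),
    ← (h1.add (summable_of_abs_le_div_factorial hb x)).tsum_add
      (summable_of_abs_le_div_factorial abs_besselCoeff_le x)]
  refine (tsum_congr fun k => ?_).trans tsum_zero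
  linear_combination x ^ k * besselCoeff_succ k

theorem exists_hasDerivAt_neumannG' (x : ℝ) :
    ∃ G'' : ℝ, HasDerivAt neumannG' G'' x ∧
      x * G'' + neumannG' x + neumannG x + besselF' x = 0 := by
  have hb := abs_shift_le_div_factorial abs_neumannCoeff_le
  have hc := abs_shift_le_div_factorial abs_besselCoeff_le
  refine ⟨_, hasDerivAt_tsum_mul_pow hb x, ?_⟩
  obtain ⟨h1, h2⟩ := mul_tsum_shift hb x
  have s1 := h1.add (summable_of_abs_le_div_factorial hb x)
  have s2 := s1.add (summable_of_abs_le_div_factorial abs_neumannCoeff_le x)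
  rw [h2, neumannG', neumannG, besselF', ← h1.tsum_add (summable_of_abs_le_div_factorial hb x),
    ← s1.tsum_add (summable_of_abs_le_div_factorial abs_neumannCoeff_le x),
    ← s2.tsum_add (summable_of_abs_le_div_factorial hc x)]
  refine (tsum_congr fun k => ?_).trans tsum_zero
  linear_combination x ^ k * neumannCoeff_succ k

theorem besselF_zero : besselF 0 = 1 := by
  rw [besselF, tsum_eq_single 0 fun k hk => by simp [hk]]
  simp [besselCoeff]

theorem bessel_neumann_wronskian (x : ℝ) :
    besselF x ^ 2 + 2 * x * (besselF x * neumannG' x - besselF' x * neumannG x) = 1 := by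
  have h : ∀ y, HasDerivAt (fun x => besselF x ^ 2 +
      2 * x * (besselF x * neumannG' x - besselF' x * neumannG x)) 0 y := fun y => by
    obtain ⟨F'', hF, eF⟩ := exists_hasDerivAt_besselF' y
    obtain ⟨G'', hG, eG⟩ := exists_hasDerivAt_neumannG' y
    refine (((hasDerivAt_besselF y).pow 2).add (((hasDerivAt_id y).const_mul 2).mul
      (((hasDerivAt_besselF y).mul hG).sub (hF.mul (hasDerivAt_neumannG y))))).congr_deriv ?_
    simp only [id, Pi.mul_apply, Pi.sub_apply]
    push_cast
    linear_combination 2 * besselF y * eG - 2 * neumannG y * eF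
  have := is_const_of_deriv_eq_zero (fun y => (h y).differentiableAt) (fun y => (h y).deriv) x 0
  rw [this]
  simp [besselF_zero]

/-- `τ^{1/2} J₀(τ)` as a real function. -/
def wPlus (τ : ℝ) : ℝ := √τ * besselF ((τ / 2) ^ 2)

/-- Derivative of `wPlus`. -/
def wPlus' (τ : ℝ) : ℝ :=
  besselF ((τ / 2) ^ 2) / (2 * √τ) + √τ * (besselF' ((τ / 2) ^ 2) * (τ / 2))

/-- `τ^{1/2} Y₀(τ)` as a real function. -/
def wMinus (τ : ℝ) : ℝ :=
  2 / π * ((log (τ / 2) + eulerMascheroniConstant) * wPlus τ + √τ * neumannG ((τ / 2) ^ 2))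

/-- Derivative of `wMinus`. -/
def wMinus' (τ : ℝ) : ℝ :=
  2 / π * ((log (τ / 2) + eulerMascheroniConstant) * wPlus' τ + wPlus τ / τ +
    (neumannG ((τ / 2) ^ 2) / (2 * √τ) + √τ * (neumannG' ((τ / 2) ^ 2) * (τ / 2))))

theorem hasDerivAt_sqrt_mul_comp {f : ℝ → ℝ} {f' τ : ℝ} (hτ : 0 < τ)
    (hf : HasDerivAt f f' ((τ / 2) ^ 2)) :
    HasDerivAt (fun τ => √τ * f ((τ / 2) ^ 2))
      (f ((τ / 2) ^ 2) / (2 * √τ) + √τ * (f' * (τ / 2))) τ := by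
  have h1 : HasDerivAt (fun τ : ℝ => (τ / 2) ^ 2) (τ / 2) τ :=
    (((hasDerivAt_id τ).div_const 2).pow 2).congr_deriv (by simp; ring)
  exact ((hasDerivAt_sqrt hτ.ne').mul (hf.comp τ h1)).congr_deriv (by
    simp only [Function.comp]; ring)

theorem hasDerivAt_sqrt_mul_comp_deriv {f f' : ℝ → ℝ} {f'' τ : ℝ} (hτ : 0 < τ)
    (hf : HasDerivAt f (f' ((τ / 2) ^ 2)) ((τ / 2) ^ 2))
    (hf' : HasDerivAt f' f'' ((τ / 2) ^ 2)) :
    HasDerivAt (fun τ => f ((τ / 2) ^ 2) / (2 * √τ) + √τ * (f' ((τ / 2) ^ 2) * (τ / 2)))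
      (√τ * ((τ / 2) ^ 2 * f'' + f' ((τ / 2) ^ 2)) -
        √τ * f ((τ / 2) ^ 2) / (4 * τ ^ 2)) τ := by
  have h1 : HasDerivAt (fun τ : ℝ => (τ / 2) ^ 2) (τ / 2) τ :=
    (((hasDerivAt_id τ).div_const 2).pow 2).congr_deriv (by simp; ring)
  have hs : 0 < √τ := sqrt_pos.2 hτ
  have h2 := hasDerivAt_sqrt hτ.ne'
  refine (((hf.comp τ h1).div (h2.const_mul 2) (by positivity)).add
    (h2.mul ((hf'.comp τ h1).mul ((hasDerivAt_id τ).div_const 2)))).congr_deriv ?_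
  simp only [Function.comp, id, Pi.mul_apply]
  obtain ⟨q, hq, rfl⟩ : ∃ q : ℝ, 0 < q ∧ τ = q ^ 2 := ⟨√τ, hs, (sq_sqrt hτ.le).symm⟩
  rw [sqrt_sq hq.le]
  field_simp
  ring

theorem hasDerivAt_wPlus {τ : ℝ} (hτ : 0 < τ) : HasDerivAt wPlus (wPlus' τ) τ :=
  hasDerivAt_sqrt_mul_comp hτ (hasDerivAt_besselF _)

theorem hasDerivAt_wPlus' {τ : ℝ} (hτ : 0 < τ) :
    HasDerivAt wPlus' (-(1 + 1 / (4 * τ ^ 2)) * wPlus τ) τ := by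
  obtain ⟨F'', hF, eF⟩ := exists_hasDerivAt_besselF' ((τ / 2) ^ 2)
  refine (hasDerivAt_sqrt_mul_comp_deriv hτ (hasDerivAt_besselF _) hF).congr_deriv ?_
  rw [wPlus]
  linear_combination √τ * eF

theorem hasDerivAt_log_half_add {τ : ℝ} (hτ : 0 < τ) :
    HasDerivAt (fun τ => log (τ / 2) + eulerMascheroniConstant) (1 / τ) τ :=
  ((((hasDerivAt_id τ).div_const 2).log (by simp; positivity)).add_const _).congr_deriv
    (by simp; field_simp)

theorem hasDerivAt_wMinus {τ : ℝ} (hτ : 0 < τ) : HasDerivAt wMinus (wMinus' τ) τ := by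
  refine ((((hasDerivAt_log_half_add hτ).mul (hasDerivAt_wPlus hτ)).add
    (hasDerivAt_sqrt_mul_comp hτ (hasDerivAt_neumannG _))).const_mul (2 / π)).congr_deriv ?_
  rw [wMinus']
  ring

theorem hasDerivAt_wMinus' {τ : ℝ} (hτ : 0 < τ) :
    HasDerivAt wMinus' (-(1 + 1 / (4 * τ ^ 2)) * wMinus τ) τ := by
  obtain ⟨G'', hG, eG⟩ := exists_hasDerivAt_neumannG' ((τ / 2) ^ 2)
  refine (((((hasDerivAt_log_half_add hτ).mul (hasDerivAt_wPlus' hτ)).add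
    ((hasDerivAt_wPlus hτ).div (hasDerivAt_id τ) hτ.ne')).add
    (hasDerivAt_sqrt_mul_comp_deriv hτ (hasDerivAt_neumannG _) hG)).const_mul
      (2 / π)).congr_deriv ?_
  simp only [wMinus, wPlus', wPlus, id]
  obtain ⟨q, hq, rfl⟩ : ∃ q : ℝ, 0 < q ∧ τ = q ^ 2 := ⟨√τ, sqrt_pos.2 hτ, (sq_sqrt hτ.le).symm⟩
  rw [sqrt_sq hq.le]
  field_simp
  field_simp at eG
  linear_combination 4 * q ^ 4 * eG

theorem wPlus_wMinus_wronskian {τ : ℝ} (hτ : 0 < τ) :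
    wPlus τ * wMinus' τ - wPlus' τ * wMinus τ = 2 / π := by
  have h := bessel_neumann_wronskian ((τ / 2) ^ 2)
  simp only [wMinus, wMinus', wPlus', wPlus]
  obtain ⟨q, hq, rfl⟩ : ∃ q : ℝ, 0 < q ∧ τ = q ^ 2 := ⟨√τ, sqrt_pos.2 hτ, (sq_sqrt hτ.le).symm⟩
  rw [sqrt_sq hq.le]
  field_simp
  field_simp at h
  linear_combination h

section Energy

variable {u u' : ℝ → ℝ} {r : ℝ}

theorem energy_le (hu : ∀ s > 0, HasDerivAt u (u' s) s)
    (hu' : ∀ s > 0, HasDerivAt u' (-(r ^ 2 + 1 / (4 * s ^ 2)) * u s) s)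
    {a s : ℝ} (ha : 0 < a) (has : a ≤ s) :
    u' s ^ 2 + (r ^ 2 + 1 / (4 * s ^ 2)) * u s ^ 2 ≤
      u' a ^ 2 + (r ^ 2 + 1 / (4 * a ^ 2)) * u a ^ 2 := by
  have hd : ∀ x > 0, HasDerivAt (fun s => u' s ^ 2 + (r ^ 2 + 1 / (4 * s ^ 2)) * u s ^ 2)
      (-(u x ^ 2 / (2 * x ^ 3))) x := fun x hx => by
    refine (((hu' x hx).pow 2).add ((((hasDerivAt_const x (1 : ℝ)).div
      (((hasDerivAt_id x).pow 2).const_mul 4) (by simp; positivity)).const_add (r ^ 2)).mul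
        ((hu x hx).pow 2))).congr_deriv ?_
    simp
    field_simp
    ring
  refine antitoneOn_of_deriv_nonpos (convex_Ici a)
    (fun x hx => (hd x (ha.trans_le hx)).continuousAt.continuousWithinAt)
    (fun x hx => ?_) (fun x hx => ?_) self_mem_Ici has has
  all_goals
    rw [interior_Ici] at hx
    have hx0 : 0 < x := ha.trans hx
  · exact (hd x hx0).differentiableAt.differentiableWithinAt
  · rw [(hd x hx0).deriv]
    exact neg_nonpos.2 (by positivity)

theorem abs_le_of_one_le_mul (hr : 0 < r) (hu : ∀ s > 0, HasDerivAt u (u' s) s)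
    (hu' : ∀ s > 0, HasDerivAt u' (-(r ^ 2 + 1 / (4 * s ^ 2)) * u s) s)
    {a s K : ℝ} (ha : 0 < a) (has : a ≤ s) (hra : 1 ≤ r * a)
    (h0 : |u a / √a| ≤ K) (h1 : |√a * u' a - u a / (2 * √a)| ≤ K) :
    |u s| ≤ 2 * √a * K := by
  have hE := energy_le hu hu' ha has
  obtain ⟨q, hq, rfl⟩ : ∃ q : ℝ, 0 < q ∧ a = q ^ 2 := ⟨√a, sqrt_pos.2 ha, (sq_sqrt ha.le).symm⟩
  rw [sqrt_sq hq.le] at *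
  have hK : 0 ≤ K := (abs_nonneg _).trans h0
  obtain ⟨v, hv⟩ : ∃ v, v = u (q ^ 2) / q := ⟨_, rfl⟩
  obtain ⟨g, hg⟩ : ∃ g, g = q * u' (q ^ 2) - u (q ^ 2) / (2 * q) := ⟨_, rfl⟩
  rw [← hv] at h0
  rw [← hg] at h1
  have e1 : u (q ^ 2) = q * v := by rw [hv]; field_simp
  have e2 : u' (q ^ 2) = (g + v / 2) / q := by rw [hg, hv]; field_simp; ring
  rw [e1, e2] at hE
  have hv2 : v ^ 2 ≤ K ^ 2 := sq_le_sq' (abs_le.1 h0).1 (abs_le.1 h0).2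
  have hgv : (g + v / 2) ^ 2 ≤ 9 / 4 * K ^ 2 := by
    obtain ⟨a1, a2⟩ := abs_le.1 h0
    obtain ⟨b1, b2⟩ := abs_le.1 h1
    nlinarith
  have hq4 : 1 ≤ (r * q ^ 2) ^ 2 := by nlinarith
  have e3 : (r ^ 2 + 1 / (4 * (q ^ 2) ^ 2)) * (q * v) ^ 2 + ((g + v / 2) / q) ^ 2 =
      ((g + v / 2) ^ 2 + v ^ 2 / 4 + (r * q ^ 2) ^ 2 * v ^ 2) / q ^ 2 := by
    field_simp; ring
  have e4 : ((g + v / 2) ^ 2 + v ^ 2 / 4 + (r * q ^ 2) ^ 2 * v ^ 2) / q ^ 2 ≤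
      r ^ 2 * (2 * q * K) ^ 2 := by
    rw [div_le_iff₀ (by positivity)]
    nlinarith [mul_le_mul_of_nonneg_left hv2 (sq_nonneg (r * q ^ 2)),
      mul_le_mul_of_nonneg_right hq4 (sq_nonneg K)]
  have e5 : 0 ≤ 1 / (4 * s ^ 2) * u s ^ 2 := by positivity
  have e6 : r ^ 2 * u s ^ 2 ≤ r ^ 2 * (2 * q * K) ^ 2 := by nlinarith [sq_nonneg (u' s)]
  exact abs_le_of_sq_le_sq (le_of_mul_le_mul_left e6 (by positivity)) (by positivity)

theorem abs_le_of_mul_le_one (hu : ∀ s > 0, HasDerivAt u (u' s) s)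
    (hu' : ∀ s > 0, HasDerivAt u' (-(r ^ 2 + 1 / (4 * s ^ 2)) * u s) s)
    {a b K : ℝ} (hr : 0 < r) (ha : 0 < a) (hab : a ≤ b) (hrb : r * b ≤ 1)
    (h0 : |u a / √a| ≤ K) (h1 : |√a * u' a - u a / (2 * √a)| ≤ K) :
    |u b / √b| ≤ 2 * K * (1 + log (b / a)) ∧
      |√b * u' b - u b / (2 * √b)| ≤ 2 * K * (1 + log (b / a)) := by
  have hK : 0 ≤ K := (abs_nonneg _).trans h0
  set v : ℝ → ℝ := fun s => u s / √s with hv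
  set g : ℝ → ℝ := fun s => √s * u' s - u s / (2 * √s) with hg
  have dv : ∀ s > 0, HasDerivAt v (g s / s) s := fun s hs => by
    refine ((hu s hs).div (hasDerivAt_sqrt hs.ne') (sqrt_pos.2 hs).ne').congr_deriv ?_
    simp only [hg]
    obtain ⟨q, hq, rfl⟩ : ∃ q : ℝ, 0 < q ∧ s = q ^ 2 := ⟨√s, sqrt_pos.2 hs, (sq_sqrt hs.le).symm⟩
    rw [sqrt_sq hq.le]
    field_simp
  have dg : ∀ s > 0, HasDerivAt g (-(r ^ 2 * s * v s)) s := fun s hs => by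
    have h2 := hasDerivAt_sqrt hs.ne'
    refine ((h2.mul (hu' s hs)).sub ((hu s hs).div (h2.const_mul 2)
      (mul_pos two_pos (sqrt_pos.2 hs)).ne')).congr_deriv ?_
    simp only [hv]
    obtain ⟨q, hq, rfl⟩ : ∃ q : ℝ, 0 < q ∧ s = q ^ 2 := ⟨√s, sqrt_pos.2 hs, (sq_sqrt hs.le).symm⟩
    rw [sqrt_sq hq.le]
    field_simp
    ring
  have pos : ∀ s ∈ Icc a b, 0 < s := fun s hs => ha.trans_le hs.1
  have cv : ContinuousOn v (Icc a b) :=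
    fun s hs => (dv s (pos s hs)).continuousAt.continuousWithinAt
  have cg : ContinuousOn g (Icc a b) :=
    fun s hs => (dg s (pos s hs)).continuousAt.continuousWithinAt
  obtain ⟨m, hm, hmax⟩ := isCompact_Icc.exists_isMaxOn (nonempty_Icc.2 hab) cv.abs
  obtain ⟨S, hS⟩ : ∃ S, S = |v m| := ⟨_, rfl⟩
  have hS0 : 0 ≤ S := hS ▸ abs_nonneg _
  have hvS : ∀ s ∈ Icc a b, |v s| ≤ S := fun s hs => hS ▸ hmax hs
  have bg : ∀ s ∈ Icc a b, |g s| ≤ K + S * r ^ 2 * s ^ 2 / 2 := fun s hs =>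
    image_norm_le_of_norm_deriv_right_le_deriv_boundary (f := g)
      (f' := fun s => -(r ^ 2 * s * v s)) (B := fun s => K + S * r ^ 2 * s ^ 2 / 2)
      (B' := fun s => S * r ^ 2 * s) cg
      (fun x hx => (dg x (pos x (Ico_subset_Icc_self hx))).hasDerivWithinAt)
      (h1.trans (le_add_of_nonneg_right (by positivity)))
      (fun x => (((((hasDerivAt_id x).pow 2).const_mul (S * r ^ 2)).div_const 2).const_add
        K).congr_deriv (by simp; ring))
      (fun x hx => by
        have hx0 := pos x (Ico_subset_Icc_self hx)
        rw [norm_neg, norm_mul, Real.norm_eq_abs, Real.norm_eq_abs,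
          abs_of_pos (by positivity : 0 < r ^ 2 * x)]
        nlinarith [mul_le_mul_of_nonneg_left (hvS x (Ico_subset_Icc_self hx))
          (by positivity : 0 ≤ r ^ 2 * x)]) hs
  have bv : ∀ s ∈ Icc a b, |v s| ≤ K + K * log (s / a) + S * r ^ 2 * s ^ 2 / 4 := fun s hs => by
    have dB : ∀ x ∈ Icc a b, HasDerivAt (fun s => K + K * log (s / a) + S * r ^ 2 * s ^ 2 / 4)
        (K / x + S * r ^ 2 * x / 2) x := fun x hx => by
      have hx0 := pos x hx
      refine ((((((hasDerivAt_id x).div_const a).log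
        (by simp; exact ⟨hx0.ne', ha.ne'⟩)).const_mul K).const_add K).add
        ((((hasDerivAt_id x).pow 2).const_mul (S * r ^ 2)).div_const 4)).congr_deriv ?_
      simp
      field_simp
      ring
    refine image_norm_le_of_norm_deriv_right_le_deriv_boundary' (f := v)
      (f' := fun s => g s / s) (B' := fun x => K / x + S * r ^ 2 * x / 2) cv
      (fun x hx => (dv x (pos x (Ico_subset_Icc_self hx))).hasDerivWithinAt)
      (h0.trans ?_)
      (fun x hx => (dB x hx).continuousAt.continuousWithinAt)
      (fun x hx => (dB x (Ico_subset_Icc_self hx)).hasDerivWithinAt) (fun x hx => ?_) hs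
    · rw [div_self ha.ne', log_one, mul_zero, add_zero]
      exact le_add_of_nonneg_right (by positivity)
    · have hx0 := pos x (Ico_subset_Icc_self hx)
      rw [norm_div, Real.norm_eq_abs, Real.norm_eq_abs, abs_of_pos hx0, div_le_iff₀ hx0]
      refine (bg x (Ico_subset_Icc_self hx)).trans_eq ?_
      field_simp
  have hrs : ∀ s ∈ Icc a b, r ^ 2 * s ^ 2 ≤ 1 := fun s hs => by
    have : r * s ≤ 1 := (mul_le_mul_of_nonneg_left hs.2 hr.le).trans hrb
    rw [← mul_pow]
    exact pow_le_one₀ (mul_pos hr (pos s hs)).le this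
  have hlog : log (m / a) ≤ log (b / a) :=
    log_le_log (div_pos (pos m hm) ha) (by gcongr; exact hm.2)
  have hL : 0 ≤ log (b / a) := log_nonneg ((one_le_div ha).2 hab)
  have hSle : S ≤ 4 / 3 * (K * (1 + log (b / a))) := by
    have := bv m hm
    rw [← hS] at this
    nlinarith [mul_le_mul_of_nonneg_left (hrs m hm) hS0, mul_le_mul_of_nonneg_left hlog hK]
  have hbm : b ∈ Icc a b := right_mem_Icc.2 hab
  have hKL := mul_nonneg hK hL
  constructor
  · nlinarith [hvS b hbm]
  · nlinarith [bg b hbm, mul_le_mul_of_nonneg_left (hrs b hbm) hS0]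

theorem exists_abs_le_sqrt_mul_log (hr : 0 < r) (hu : ∀ s > 0, HasDerivAt u (u' s) s)
    (hu' : ∀ s > 0, HasDerivAt u' (-(r ^ 2 + 1 / (4 * s ^ 2)) * u s) s)
    {a s K : ℝ} (ha : 0 < a) (has : a ≤ s)
    (h0 : |u a / √a| ≤ K) (h1 : |√a * u' a - u a / (2 * √a)| ≤ K) :
    ∃ m, a ≤ m ∧ m ≤ s ∧ (r * m ≤ 1 ∨ m = a) ∧ |u s| ≤ 4 * K * √m * (1 + log (m / a)) := by
  have hK : 0 ≤ K := (abs_nonneg _).trans h0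
  rcases le_total 1 (r * a) with hra | hra
  · refine ⟨a, le_rfl, has, Or.inr rfl, ?_⟩
    rw [div_self ha.ne', log_one]
    nlinarith [abs_le_of_one_le_mul hr hu hu' ha has hra h0 h1, mul_nonneg hK (sqrt_nonneg a)]
  rcases le_total (r * s) 1 with hrs | hrs
  · refine ⟨s, has, le_rfl, Or.inl hrs, ?_⟩
    have hs := sqrt_pos.2 (ha.trans_le has)
    have h := (abs_le_of_mul_le_one hu hu' hr ha has hrs h0 h1).1
    rw [abs_div, abs_of_pos hs, div_le_iff₀ hs] at h
    have := mul_nonneg (mul_nonneg hK (add_nonneg zero_le_one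
      (log_nonneg ((one_le_div ha).2 has)))) hs.le
    nlinarith
  · have ham : a ≤ 1 / r := (le_div_iff₀' hr).2 hra
    have hms : 1 / r ≤ s := (div_le_iff₀' hr).2 hrs
    have hrm : r * (1 / r) = 1 := mul_one_div_cancel hr.ne'
    refine ⟨1 / r, ham, hms, Or.inl hrm.le, ?_⟩
    obtain ⟨h2, h3⟩ := abs_le_of_mul_le_one hu hu' hr ha ham hrm.le h0 h1
    refine (abs_le_of_one_le_mul hr hu hu' (by positivity) hms hrm.ge h2 h3).trans_eq ?_
    ring

end Energy

section Propagator

theorem besselJ_zero_eq (τ : ℝ) : besselJ 0 τ = (besselF ((τ / 2) ^ 2) : ℂ) := by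
  rw [besselJ, besselF, Complex.ofReal_tsum]
  refine tsum_congr fun k => ?_
  have h : (0 : ℂ) + 2 * (k : ℂ) = ((2 * k : ℕ) : ℂ) := by push_cast; ring
  rw [h, Complex.cpow_natCast, zero_add, Complex.Gamma_nat_eq_factorial, pow_mul, besselCoeff]
  push_cast
  rw [sq (k.factorial : ℂ)]

theorem besselY0_eq {τ : ℝ} (hτ : 0 < τ) :
    besselY0 τ = ((2 / π * ((log (τ / 2) + eulerMascheroniConstant) * besselF ((τ / 2) ^ 2) +
      neumannG ((τ / 2) ^ 2)) : ℝ) : ℂ) := by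
  have h : Summable fun k => neumannCoeff k * ((τ / 2) ^ 2) ^ k :=
    summable_of_abs_le_div_factorial abs_neumannCoeff_le _
  have hG : (neumannG ((τ / 2) ^ 2) : ℂ) = ∑' k : ℕ,
      ((-1 : ℂ) ^ ((k + 1) + 1) * ((harmonic (k + 1) : ℚ) : ℂ) /
          ((Nat.factorial (k + 1) : ℂ)) ^ 2) * ((τ : ℂ) / 2) ^ (2 * (k + 1)) := by
    rw [neumannG, h.tsum_eq_zero_add, show neumannCoeff 0 = 0 by simp [neumannCoeff], zero_mul,
      zero_add, Complex.ofReal_tsum]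
    refine tsum_congr fun k => ?_
    rw [neumannCoeff, pow_mul]
    push_cast
    rfl
  rw [besselY0, ← hG, besselJ_zero_eq, show (τ : ℂ) / 2 = ((τ / 2 : ℝ) : ℂ) by push_cast; rfl,
    ← Complex.ofReal_log (by positivity)]
  push_cast
  ring

theorem ePlus_zero_eq (r t : ℝ) : ePlus 0 r t = (wPlus ((1 + t) * r) : ℂ) := by
  rw [ePlus, besselJ_zero_eq, wPlus]
  push_cast
  rfl

theorem eMinusZ_eq {r t : ℝ} (hr : 0 < r) (ht : -1 < t) :
    eMinusZ r t = (wMinus ((1 + t) * r) : ℂ) := by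
  rw [eMinusZ, besselY0_eq (mul_pos (by linarith) hr), wMinus, wPlus]
  push_cast
  ring

theorem ePlusDot_zero_eq {r t : ℝ} (hr : 0 < r) (ht : -1 < t) :
    ePlusDot 0 r t = ((r * wPlus' ((1 + t) * r) : ℝ) : ℂ) := by
  have h : HasDerivAt (fun t : ℝ => (1 + t) * r) r t :=
    (((hasDerivAt_id t).const_add 1).mul_const r).congr_deriv (one_mul r)
  rw [ePlusDot, funext (ePlus_zero_eq r)]
  refine (((hasDerivAt_wPlus (mul_pos (by linarith) hr)).comp t h).ofReal_comp.congr_deriv ?_).deriv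
  rw [mul_comm]

theorem eMinusZDot_eq {r t : ℝ} (hr : 0 < r) (ht : -1 < t) :
    eMinusZDot r t = ((r * wMinus' ((1 + t) * r) : ℝ) : ℂ) := by
  have h : HasDerivAt (fun t : ℝ => (1 + t) * r) r t :=
    (((hasDerivAt_id t).const_add 1).mul_const r).congr_deriv (one_mul r)
  have he : eMinusZ r =ᶠ[nhds t] fun t => (wMinus ((1 + t) * r) : ℂ) :=
    Filter.eventually_of_mem (Ioi_mem_nhds ht) fun s hs => eMinusZ_eq hr hs
  rw [eMinusZDot, he.deriv_eq]
  refine (((hasDerivAt_wMinus (mul_pos (by linarith) hr)).comp t h).ofReal_comp.congr_deriv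
    ?_).deriv
  rw [mul_comm]

/-- The general solution of the wave equation with mass term `1 / (4 s²)` at frequency `r`. -/
def waveSol (r c d s : ℝ) : ℝ := c * wPlus (s * r) + d * wMinus (s * r)

/-- Derivative of `waveSol`. -/
def waveSol' (r c d s : ℝ) : ℝ := r * (c * wPlus' (s * r) + d * wMinus' (s * r))

theorem hasDerivAt_waveSol {r : ℝ} (hr : 0 < r) (c d : ℝ) {s : ℝ} (hs : 0 < s) :
    HasDerivAt (waveSol r c d) (waveSol' r c d s) s := by
  have h : HasDerivAt (fun s : ℝ => s * r) r s := hasDerivAt_mul_const r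
  have hsr := mul_pos hs hr
  refine ((((hasDerivAt_wPlus hsr).comp s h).const_mul c).add
    (((hasDerivAt_wMinus hsr).comp s h).const_mul d)).congr_deriv ?_
  rw [waveSol']
  ring

theorem hasDerivAt_waveSol' {r : ℝ} (hr : 0 < r) (c d : ℝ) {s : ℝ} (hs : 0 < s) :
    HasDerivAt (waveSol' r c d) (-(r ^ 2 + 1 / (4 * s ^ 2)) * waveSol r c d s) s := by
  have h : HasDerivAt (fun s : ℝ => s * r) r s := hasDerivAt_mul_const r
  have hsr := mul_pos hs hr
  refine (((((hasDerivAt_wPlus' hsr).comp s h).const_mul c).add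
    (((hasDerivAt_wMinus' hsr).comp s h).const_mul d)).const_mul r).congr_deriv ?_
  rw [waveSol]
  field_simp
  ring

theorem exists_E0Z_eq {r t₀ : ℝ} (hr : 0 < r) (ht₀ : -1 < t₀) : ∃ c d : ℝ,
    waveSol r c d (1 + t₀) = 1 ∧ waveSol' r c d (1 + t₀) = 0 ∧
      ∀ t > -1, E0Z r t t₀ = (waveSol r c d (1 + t) : ℂ) := by
  have hW := wPlus_wMinus_wronskian (mul_pos (by linarith : 0 < 1 + t₀) hr)
  have hpi := pi_pos.ne'
  refine ⟨π / 2 * wMinus' ((1 + t₀) * r), -(π / 2 * wPlus' ((1 + t₀) * r)), ?_, ?_,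
    fun t ht => ?_⟩
  · rw [waveSol]
    field_simp at hW ⊢
    linear_combination hW
  · rw [waveSol']
    ring
  · rw [E0Z, ePlus_zero_eq, ePlus_zero_eq, eMinusZ_eq hr ht, eMinusZ_eq hr ht₀,
      ePlusDot_zero_eq hr ht₀, eMinusZDot_eq hr ht₀]
    norm_cast
    rw [waveSol, div_eq_iff]
    · generalize (1 + t) * r = x
      generalize (1 + t₀) * r = y at hW ⊢
      field_simp at hW ⊢
      linear_combination (-1) * (wPlus x * wMinus' y -
        wPlus' y * wMinus x) * hW
    · have : r * (2 / π) ≠ 0 := by positivity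
      rw [← hW] at this
      convert this using 1
      ring

theorem exists_E1Z_eq {r t₀ : ℝ} (hr : 0 < r) (ht₀ : -1 < t₀) : ∃ c d : ℝ,
    waveSol r c d (1 + t₀) = 0 ∧ waveSol' r c d (1 + t₀) = 1 ∧
      ∀ t > -1, E1Z r t t₀ = (waveSol r c d (1 + t) : ℂ) := by
  have hW := wPlus_wMinus_wronskian (mul_pos (by linarith : 0 < 1 + t₀) hr)
  have hpi := pi_pos.ne'
  refine ⟨-(π / (2 * r) * wMinus ((1 + t₀) * r)), π / (2 * r) * wPlus ((1 + t₀) * r), ?_, ?_,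
    fun t ht => ?_⟩
  · rw [waveSol]
    ring
  · rw [waveSol']
    field_simp at hW ⊢
    linear_combination hW
  · rw [E1Z, ePlus_zero_eq, ePlus_zero_eq, eMinusZ_eq hr ht, eMinusZ_eq hr ht₀,
      ePlusDot_zero_eq hr ht₀, eMinusZDot_eq hr ht₀]
    norm_cast
    rw [waveSol, div_eq_iff]
    · generalize (1 + t) * r = x
      generalize (1 + t₀) * r = y at hW ⊢
      field_simp at hW ⊢
      linear_combination (-1) * (wPlus y * wMinus x -
        wPlus x * wMinus y) * hW
    · have : r * (2 / π) ≠ 0 := by positivity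
      rw [← hW] at this
      convert this using 1
      ring

theorem deriv_eq_waveSol' {r c d : ℝ} (hr : 0 < r) {f : ℝ → ℂ}
    (hf : ∀ t > -1, f t = (waveSol r c d (1 + t) : ℂ)) {t : ℝ} (ht : -1 < t) :
    deriv f t = (waveSol' r c d (1 + t) : ℂ) := by
  have he : f =ᶠ[nhds t] fun t => (waveSol r c d (1 + t) : ℂ) :=
    Filter.eventually_of_mem (Ioi_mem_nhds ht) hf
  rw [he.deriv_eq]
  exact ((hasDerivAt_waveSol hr c d (by linarith)).comp_const_add 1 t).ofReal_comp.deriv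

theorem sqrt_mul_one_add_log_le {ε x : ℝ} (hε : 0 < ε) (hx : 1 ≤ x) :
    √x * (1 + log x) ≤ (1 + 1 / ε) * x ^ (1 / 2 + ε) := by
  have hx0 : 0 < x := by linarith
  have h1 := log_le_rpow_div hx0.le hε
  have h2 := one_le_rpow hx hε.le
  rw [rpow_add hx0, ← sqrt_eq_rpow]
  have h3 : 1 + log x ≤ (1 + 1 / ε) * x ^ ε := by
    rw [add_mul, one_mul, one_div_mul_eq_div]
    linarith
  nlinarith [mul_le_mul_of_nonneg_left h3 (sqrt_nonneg x)]

theorem norm_E0Z_bounds {r ε t t₀ : ℝ} (hr : 0 < r) (hε : ε ∈ Ioo (0 : ℝ) 1) (ht₀ : 0 ≤ t₀)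
    (ht : t₀ ≤ t) :
    ‖E0Z r t t₀‖ ≤ 4 * (1 + 1 / ε) * (1 + r ^ (-(1 / 2 : ℝ) - ε)) ∧
      ‖E0Z r t t₀‖ ≤ 4 * (1 + t) ^ ((1 : ℝ) / 2) * (1 + t₀) ^ (-(1 : ℝ) / 2) *
        (1 + log ((1 + t) / (1 + t₀))) ∧
      ‖E0Zdot r t t₀‖ ≤ 1 + r := by
  obtain ⟨c, d, h0, h1, hE⟩ := exists_E0Z_eq hr (by linarith : -1 < t₀)
  have ht' : -1 < t := by linarith
  rw [E0Zdot, deriv_eq_waveSol' hr hE ht', hE t ht', Complex.norm_real, Complex.norm_real,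
    Real.norm_eq_abs, Real.norm_eq_abs]
  have ha1 : 1 ≤ 1 + t₀ := by linarith
  have hat : 1 + t₀ ≤ 1 + t := by linarith
  generalize 1 + t₀ = a at *
  generalize 1 + t = s at *
  have ha : 0 < a := by linarith
  have hsa := sqrt_pos.2 ha
  have hu := fun s (hs : s > 0) => hasDerivAt_waveSol hr c d hs
  have hu' := fun s (hs : s > 0) => hasDerivAt_waveSol' hr c d hs
  have hen := energy_le hu hu' ha hat
  obtain ⟨m, ham, hms, hm, hle⟩ := exists_abs_le_sqrt_mul_log (K := 1 / √a) hr hu hu' ha hat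
    (by rw [h0, abs_of_pos (by positivity)])
    (by rw [h0, h1, mul_zero, zero_sub, abs_neg, abs_of_pos (by positivity)]
        exact one_div_le_one_div_of_le hsa (by linarith))
  have hxa : 1 ≤ m / a := (one_le_div ha).2 ham
  have hxs : m / a ≤ s / a := by gcongr
  have hle' : |waveSol r c d s| ≤ 4 * (√(m / a) * (1 + log (m / a))) := by
    refine hle.trans_eq ?_
    rw [sqrt_div (by linarith)]
    ring
  have hlog := log_nonneg hxa
  refine ⟨?_, ?_, ?_⟩
  · refine hle'.trans ?_
    have hε' : 0 < 1 / ε := one_div_pos.2 hε.1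
    have hpow : 0 < r ^ (-(1 / 2 : ℝ) - ε) := by positivity
    rcases hm with hm | rfl
    · have hx : m / a ≤ r⁻¹ := by
        rw [inv_eq_one_div, div_le_div_iff₀ ha hr]
        nlinarith
      have h2 : (m / a) ^ (1 / 2 + ε) ≤ r ^ (-(1 / 2 : ℝ) - ε) := by
        refine (rpow_le_rpow (by linarith) hx (by linarith [hε.1])).trans_eq ?_
        rw [inv_rpow hr.le, ← rpow_neg hr.le]
        congr 1
        ring
      nlinarith [sqrt_mul_one_add_log_le hε.1 hxa,
        mul_le_mul_of_nonneg_left h2 (by linarith : 0 ≤ 1 + 1 / ε)]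
    · rw [div_self ha.ne', log_one, sqrt_one]
      nlinarith [mul_pos hε' hpow]
  · refine hle'.trans ?_
    have e : 4 * s ^ ((1 : ℝ) / 2) * a ^ (-(1 : ℝ) / 2) * (1 + log (s / a)) =
        4 * (√(s / a) * (1 + log (s / a))) := by
      rw [neg_div, rpow_neg ha.le, ← sqrt_eq_rpow, ← sqrt_eq_rpow, sqrt_div (by linarith)]
      ring
    rw [e]
    gcongr
  · refine abs_le_of_sq_le_sq ?_ (by positivity)
    have h2 : 1 / (4 * a ^ 2) ≤ 1 := by
      rw [div_le_one (by positivity)]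
      nlinarith
    have h3 : 0 ≤ (r ^ 2 + 1 / (4 * s ^ 2)) * waveSol r c d s ^ 2 := by positivity
    rw [h0, h1] at hen
    nlinarith

theorem norm_E1Z_bounds {r t t₀ : ℝ} (hr : 0 < r) (ht₀ : 0 ≤ t₀) (ht : t₀ ≤ t) :
    ‖E1Z r t t₀‖ ≤ r⁻¹ ∧
      ‖E1Z r t t₀‖ ≤ 4 * (1 + t) ^ ((1 : ℝ) / 2) * (1 + t₀) ^ ((1 : ℝ) / 2) *
        (1 + log ((1 + t) / (1 + t₀))) ∧
      ‖E1Zdot r t t₀‖ ≤ 1 := by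
  obtain ⟨c, d, h0, h1, hE⟩ := exists_E1Z_eq hr (by linarith : -1 < t₀)
  have ht' : -1 < t := by linarith
  rw [E1Zdot, deriv_eq_waveSol' hr hE ht', hE t ht', Complex.norm_real, Complex.norm_real,
    Real.norm_eq_abs, Real.norm_eq_abs]
  have ha : 0 < 1 + t₀ := by linarith
  have hat : 1 + t₀ ≤ 1 + t := by linarith
  generalize 1 + t₀ = a at *
  generalize 1 + t = s at *
  have hu := fun s (hs : s > 0) => hasDerivAt_waveSol hr c d hs
  have hu' := fun s (hs : s > 0) => hasDerivAt_waveSol' hr c d hs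
  have hen := energy_le hu hu' ha hat
  rw [h0, h1] at hen
  have hs : 0 ≤ 1 / (4 * s ^ 2) * waveSol r c d s ^ 2 := by positivity
  refine ⟨?_, ?_, ?_⟩
  · rw [inv_eq_one_div, le_div_iff₀ hr, ← abs_of_pos hr, ← abs_mul, abs_of_pos hr]
    refine abs_le_of_sq_le_sq ?_ zero_le_one
    nlinarith [sq_nonneg (waveSol' r c d s)]
  · obtain ⟨m, ham, hms, -, hle⟩ := exists_abs_le_sqrt_mul_log (K := √a) hr hu hu' ha hat
      (by rw [h0, zero_div, abs_zero]; positivity)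
      (by rw [h0, h1, mul_one, zero_div, sub_zero, abs_of_nonneg (sqrt_nonneg a)])
    have hlog := log_nonneg ((one_le_div ha).2 ham)
    have hm : 0 < m := ha.trans_le ham
    refine hle.trans ?_
    rw [← sqrt_eq_rpow, ← sqrt_eq_rpow, mul_right_comm 4 (√s)]
    gcongr
  · refine abs_le_of_sq_le_sq ?_ zero_le_one
    nlinarith [mul_nonneg (sq_nonneg r) (sq_nonneg (waveSol r c d s))]

end Propagator

/-- case `μ = 1/4` (`ν = 0`): uniform multiplier bounds for
`E₀, E₁, Ė₀, Ė₁` for all `t ≥ t₀ ≥ 0` and `ξ ≠ 0`, with a small loss `ε ∈ (0,1)`. -/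
theorem stmt12 (d : ℕ) (hd : 1 ≤ d) (ε : ℝ) (hε : ε ∈ Set.Ioo (0 : ℝ) 1) :
    ∃ C > (0 : ℝ), ∀ t t₀ : ℝ, 0 ≤ t₀ → t₀ ≤ t →
      ∀ ξ : EuclideanSpace ℝ (Fin d), ξ ≠ 0 →
        ‖E0Z ‖ξ‖ t t₀‖ ≤ C * (1 + ‖ξ‖ ^ (-(1 / 2 : ℝ) - ε)) ∧
        ‖E0Z ‖ξ‖ t t₀‖ ≤
          C * (1 + t) ^ ((1 : ℝ) / 2) * (1 + t₀) ^ (-(1 : ℝ) / 2) *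
            (1 + Real.log ((1 + t) / (1 + t₀))) ∧
        ‖E1Z ‖ξ‖ t t₀‖ ≤ C * ‖ξ‖⁻¹ ∧
        ‖E1Z ‖ξ‖ t t₀‖ ≤
          C * (1 + t) ^ ((1 : ℝ) / 2) * (1 + t₀) ^ ((1 : ℝ) / 2) *
            (1 + Real.log ((1 + t) / (1 + t₀))) ∧
        ‖E0Zdot ‖ξ‖ t t₀‖ ≤ C * (1 + ‖ξ‖) ∧
        ‖E1Zdot ‖ξ‖ t t₀‖ ≤ C := by
  have h4 : 4 ≤ 4 * (1 + 1 / ε) := by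
    have := one_div_pos.2 hε.1
    linarith
  refine ⟨4 * (1 + 1 / ε), by linarith, fun t t₀ ht₀ ht ξ hξ => ?_⟩
  have hr := norm_pos_iff.2 hξ
  obtain ⟨a1, a2, a3⟩ := norm_E0Z_bounds hr hε ht₀ ht
  obtain ⟨b1, b2, b3⟩ := norm_E1Z_bounds hr ht₀ ht
  have hlog : 0 ≤ log ((1 + t) / (1 + t₀)) :=
    log_nonneg ((one_le_div (by linarith)).2 (by linarith))
  have ht₁ : 0 ≤ 1 + t := by linarith
  have ht₂ : 0 ≤ 1 + t₀ := by linarith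
  refine ⟨a1, a2.trans (by gcongr), b1.trans ?_, b2.trans (by gcongr), a3.trans ?_, by linarith⟩
  · exact le_mul_of_one_le_left (by positivity) (by linarith)
  · exact le_mul_of_one_le_left (by positivity) (by linarith)


end
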